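/- Let (C, d) be a filtered complex over a PID R with finite filtration, and fix r₀ ≥ 0. Suppose Tor E^{r₀}(C) is finite and that rank_R E^{r₀}(C) = rank_R H_*(C) and |Tor E^{r₀}(C)| = |Tor H_*(C)|. Then the spectral sequence of C degenerates at r₀, i.e. d^r_p = 0 for all r ≥ r₀ and all p. -/

import Mathlib

open LinearMap Submodule

/-- A *filtered complex* over `R`: a chain complex `(C, d)` together with a direct
sum decomposition `C = ⊕_{i₀ ≤ i ≤ i₁} Cᵢ` (here `G i`), such that
`d(Cᵢ) ⊆ ⊕_{j ≥ i} Cⱼ`.  (The ambient `ℤ/4`-grading plays no role in the filtered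
algebra and is omitted.) -/
structure FilteredCx (R : Type*) (C : Type*) [CommRing R] [AddCommGroup C]
    [Module R C] where
  d : C →ₗ[R] C
  dd : d ∘ₗ d = 0
  G : ℤ → Submodule R C
  internal : DirectSum.IsInternal fun i : ℤ => G i
  i₀ : ℤ
  i₁ : ℤ
  hGlow : ∀ i : ℤ, i < i₀ → G i = ⊥
  hGhigh : ∀ i : ℤ, i₁ < i → G i = ⊥
  hdG : ∀ i : ℤ, (G i).map d ≤ ⨆ j : ℤ, ⨆ _ : i ≤ j, G j

namespace FilteredCx

variable {R C : Type*} [CommRing R] [AddCommGroup C] [Module R C]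

/-- The filtration `F_pC = ⊕_{i ≥ p} Cᵢ`. -/
def F (X : FilteredCx R C) (p : ℤ) : Submodule R C :=
  ⨆ j : ℤ, ⨆ _ : p ≤ j, X.G j

/-- `{x ∈ F_pC : dx ∈ F_{p+r}C}`. -/
def zmod (X : FilteredCx R C) (r : ℕ) (p : ℤ) : Submodule R C :=
  X.F p ⊓ Submodule.comap X.d (X.F (p + r))

/-- `F_{p+1}C + d(F_{p−r+1}C)`. -/
def bmod (X : FilteredCx R C) (r : ℕ) (p : ℤ) : Submodule R C :=
  X.F (p + 1) ⊔ Submodule.map X.d (X.F (p - r + 1))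

/-- The spectral sequence page
`E^r_p(C) = {x ∈ F_pC : dx ∈ F_{p+r}C} / (F_{p+1}C + d(F_{p−r+1}C))`. -/
abbrev Epage (X : FilteredCx R C) (r : ℕ) (p : ℤ) : Type _ :=
  ↥(X.zmod r p) ⧸ Submodule.comap (X.zmod r p).subtype (X.bmod r p)

/-- The class `[x]^r_p ∈ E^r_p(C)` of an element `x ∈ F_pC` with `dx ∈ F_{p+r}C`. -/
def eClass (X : FilteredCx R C) (r : ℕ) (p : ℤ) (x : C) (hx : x ∈ X.zmod r p) :
    X.Epage r p :=
  Submodule.Quotient.mk ⟨x, hx⟩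

/-- The homology `H_*(C) = Ker d / Im d`. -/
abbrev Hmod (X : FilteredCx R C) : Type _ :=
  ↥(LinearMap.ker X.d) ⧸
    Submodule.comap (LinearMap.ker X.d).subtype (LinearMap.range X.d)

/-- The induced filtration `F_pH_*(C) = {[x] ∈ H_*(C) : dx = 0, x ∈ F_pC}`. -/
def FH (X : FilteredCx R C) (p : ℤ) : Submodule R X.Hmod :=
  Submodule.map
    (Submodule.comap (LinearMap.ker X.d).subtype (LinearMap.range X.d)).mkQ
    (Submodule.comap (LinearMap.ker X.d).subtype (X.F p))

/-- The associated graded piece `G_pH_*(C) = F_pH_*(C)/F_{p+1}H_*(C)`. -/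
abbrev GH (X : FilteredCx R C) (p : ℤ) : Type _ :=
  ↥(X.FH p) ⧸ Submodule.comap (X.FH p).subtype (X.FH (p + 1))

end FilteredCx

section Helpers

theorem aux_rank_nullity {R K E : Type*} [CommRing R] [IsDomain R] [AddCommGroup K] [Module R K]
    [AddCommGroup E] [Module R E] [Module.Finite R K] (f : K →ₗ[R] E) :
    Module.finrank R (LinearMap.range f) + Module.finrank R (LinearMap.ker f) =
      Module.finrank R K := by
  rw [← f.quotKerEquivRange.finrank_eq]
  exact Submodule.finrank_quotient_add_finrank _

/-- `K → E`, `K ↠ G` with `ker f ≤ ker g`: then `G` has rank at most that of `E`. -/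
theorem aux_rank_le {R K E G : Type*} [CommRing R] [IsDomain R] [AddCommGroup K] [Module R K]
    [AddCommGroup E] [Module R E] [AddCommGroup G] [Module R G] [IsNoetherianRing R]
    [Module.Finite R K] [Module.Finite R E]
    (f : K →ₗ[R] E) (g : K →ₗ[R] G) (hg : Function.Surjective g)
    (hfg : LinearMap.ker f ≤ LinearMap.ker g) :
    Module.finrank R G ≤ Module.finrank R E ∧
    (Module.finrank R G = Module.finrank R E → ∀ k, g k = 0 → f k ∈ Submodule.torsion R E) := by
  have h1 := aux_rank_nullity f
  have h2 := aux_rank_nullity g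
  have h3 := aux_rank_nullity (f.domRestrict (LinearMap.ker g))
  have h4 : Module.finrank R (LinearMap.range g) = Module.finrank R G := by
    rw [LinearMap.range_eq_top.2 hg]; exact finrank_top R G
  have h5 : Module.finrank R (LinearMap.range f) ≤ Module.finrank R E := Submodule.finrank_le _
  have h6 : Module.finrank R (LinearMap.ker (f.domRestrict (LinearMap.ker g))) =
      Module.finrank R (LinearMap.ker f) := by
    rw [LinearMap.ker_domRestrict]
    exact (Submodule.comapSubtypeEquivOfLe hfg).finrank_eq
  refine ⟨by omega, fun h k hk => ?_⟩
  have h7 : Module.finrank R (LinearMap.range (f.domRestrict (LinearMap.ker g))) = 0 := by omega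
  rw [Module.finrank_eq_zero_iff] at h7
  obtain ⟨a, ha, h8⟩ := h7 ⟨f k, ⟨⟨k, hk⟩, rfl⟩⟩
  rw [Submodule.mem_torsion_iff]
  exact ⟨⟨a, mem_nonZeroDivisors_of_ne_zero ha⟩, congrArg Subtype.val h8⟩

theorem aux_tor {R K E G : Type*} [CommRing R] [IsDomain R] [AddCommGroup K] [Module R K]
    [AddCommGroup E] [Module R E] [AddCommGroup G] [Module R G]
    (f : K →ₗ[R] E) (g : K →ₗ[R] G) (hg : Function.Surjective g)
    (hfg : LinearMap.ker f ≤ LinearMap.ker g)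
    (ht : ∀ k, g k = 0 → f k ∈ Submodule.torsion R E)
    (hfin : Finite (Submodule.torsion R E)) :
    Finite (Submodule.torsion R G) ∧
    Nat.card (Submodule.torsion R G) ≤ Nat.card (Submodule.torsion R E) ∧
    (Nat.card (Submodule.torsion R G) = Nat.card (Submodule.torsion R E) →
      ∀ k, g k = 0 → f k = 0) := by
  have hs : ∀ x, g x ∈ Submodule.torsion R G → f x ∈ Submodule.torsion R E := by
    intro x hx
    rw [Submodule.mem_torsion_iff] at hx
    obtain ⟨a, ha⟩ := hx
    have ha' : g ((a : R) • x) = 0 := by rw [map_smul]; exact ha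
    have := ht _ ha'
    rw [Submodule.mem_torsion_iff] at this ⊢
    obtain ⟨b, hb⟩ := this
    refine ⟨b * a, ?_⟩
    rw [mul_smul]
    rw [map_smul] at hb
    exact hb
  have hinj : ∀ x y, f x = f y → g x = g y := by
    intro x y h
    have : x - y ∈ LinearMap.ker f := by simp [h]
    have := hfg this
    rw [LinearMap.mem_ker, map_sub, sub_eq_zero] at this
    exact this
  choose s hs' using hg
  let j : Submodule.torsion R G → Submodule.torsion R E :=
    fun t => ⟨f (s t), hs _ (by rw [hs']; exact t.2)⟩
  have hj : Function.Injective j := by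
    intro t u h
    have := hinj _ _ (congrArg Subtype.val h)
    rw [hs', hs'] at this
    exact Subtype.ext this
  have hG : Finite (Submodule.torsion R G) := Finite.of_injective j hj
  refine ⟨hG, Nat.card_le_card_of_injective j hj, fun h k hk => ?_⟩
  have hbij : Function.Bijective j := (Nat.bijective_iff_injective_and_card j).2 ⟨hj, h⟩
  have key : ∀ k, g k = 0 → f k = f (s 0) := by
    intro k hk
    obtain ⟨t, ht'⟩ := hbij.2 ⟨f k, ht k hk⟩
    have h1 : f (s t) = f k := congrArg Subtype.val ht'
    have h2 := hinj _ _ h1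
    rw [hs', hk] at h2
    rw [← h1, h2]
  rw [key k hk, ← key 0 (map_zero g), map_zero]

theorem aux_tor_ses {R N : Type*} [CommRing R] [IsDomain R] [AddCommGroup N] [Module R N]
    (N' : Submodule R N) (hN : Finite (Submodule.torsion R N))
    (hQ : Finite (Submodule.torsion R (N ⧸ N'))) :
    Nat.card (Submodule.torsion R N) ≤
      Nat.card (Submodule.torsion R (N ⧸ N')) * Nat.card (Submodule.torsion R N') := by
  have hN' : Finite (Submodule.torsion R N') := by
    refine Finite.of_injective (β := Submodule.torsion R N) (fun x => ⟨x.1.1, ?_⟩) ?_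
    · have := x.2
      rw [Submodule.mem_torsion_iff] at this ⊢
      obtain ⟨a, ha⟩ := this
      exact ⟨a, congrArg Subtype.val ha⟩
    · intro x y h
      exact Subtype.ext (Subtype.ext (Subtype.mk.inj h))
  let g : Submodule.torsion R N → Submodule.torsion R (N ⧸ N') := fun x => ⟨N'.mkQ x, by
    have := x.2
    rw [Submodule.mem_torsion_iff] at this ⊢
    obtain ⟨a, ha⟩ := this
    refine ⟨a, ?_⟩
    have h2 := congrArg N'.mkQ ha
    rw [map_zero] at h2
    rw [← h2]; exact (N'.mkQ.map_smul (a : R) (x : N)).symm⟩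
  let s : Submodule.torsion R (N ⧸ N') → Submodule.torsion R N := Function.invFun g
  have hs : ∀ x, g (s (g x)) = g x := fun x => Function.invFun_eq ⟨x, rfl⟩
  have hm : ∀ x, (x - s (g x) : N) ∈ N' := by
    intro x
    rw [← Submodule.Quotient.eq]
    exact (congrArg Subtype.val (hs x)).symm
  let φ : Submodule.torsion R N → Submodule.torsion R (N ⧸ N') × Submodule.torsion R N' :=
    fun x => (g x, ⟨⟨x - s (g x), hm x⟩, by
      have := (x - s (g x)).2
      rw [Submodule.mem_torsion_iff] at this ⊢
      obtain ⟨a, ha⟩ := this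
      exact ⟨a, Subtype.ext ha⟩⟩)
  rw [← Nat.card_prod]
  refine Nat.card_le_card_of_injective φ ?_
  intro x y h
  have h1 : g x = g y := congrArg Prod.fst h
  have h2 : (x - s (g x) : N) = y - s (g y) :=
    congrArg (fun z => ((z.2 : N') : N)) h
  rw [h1] at h2
  exact Subtype.ext (sub_left_injective h2)

theorem aux_tor_sub {R N : Type*} [CommRing R] [IsDomain R] [AddCommGroup N] [Module R N]
    (N' : Submodule R N) (hN : Finite (Submodule.torsion R N)) :
    Finite (Submodule.torsion R N') := by
  refine Finite.of_injective (β := Submodule.torsion R N) (fun x => ⟨x.1.1, ?_⟩) ?_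
  · have := x.2
    rw [Submodule.mem_torsion_iff] at this ⊢
    obtain ⟨a, ha⟩ := this
    exact ⟨a, congrArg Subtype.val ha⟩
  · intro x y h
    exact Subtype.ext (Subtype.ext (Subtype.mk.inj h))

theorem aux_tor_equiv {R M N : Type*} [CommRing R] [IsDomain R] [AddCommGroup N] [Module R N]
    [AddCommGroup M] [Module R M] (e : M ≃ₗ[R] N) :
    Nat.card (Submodule.torsion R M) = Nat.card (Submodule.torsion R N) := by
  refine Nat.card_congr (e.toEquiv.subtypeEquiv fun x => ?_)
  change x ∈ Submodule.torsion R M ↔ e x ∈ Submodule.torsion R N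
  rw [Submodule.mem_torsion_iff, Submodule.mem_torsion_iff]
  refine exists_congr fun a => ?_
  have : a • e x = e (a • x) := (e.map_smul (a : R) x).symm
  rw [this, e.map_eq_zero_iff]

theorem aux_filt_rank {R H : Type*} [CommRing R] [IsDomain R] [IsNoetherianRing R]
    [AddCommGroup H] [Module R H] [Module.Finite R H] (A : ℤ → Submodule R H)
    (hA : ∀ p, A (p + 1) ≤ A p) (a : ℤ) (n : ℕ) :
    Module.finrank R (A a) = ∑ i ∈ Finset.range n,
      Module.finrank R (A (a + i) ⧸ Submodule.comap (A (a + i)).subtype (A (a + i + 1)))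
      + Module.finrank R (A (a + n)) := by
  induction n with
  | zero =>
    have h0 : a + ((0 : ℕ) : ℤ) = a := by simp
    rw [h0, Finset.sum_range_zero, zero_add]
  | succ n ih =>
    have h1 := Submodule.finrank_quotient_add_finrank
      (Submodule.comap (A (a + n)).subtype (A (a + n + 1)))
    have h2 := (Submodule.comapSubtypeEquivOfLe (hA (a + n))).finrank_eq
    have h3 : a + ((n + 1 : ℕ) : ℤ) = a + n + 1 := by push_cast; ring
    rw [Finset.sum_range_succ, h3]
    omega

theorem aux_filt_tor {R H : Type*} [CommRing R] [IsDomain R]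
    [AddCommGroup H] [Module R H] (hH : Finite (Submodule.torsion R H)) (A : ℤ → Submodule R H)
    (hA : ∀ p, A (p + 1) ≤ A p) (a : ℤ) (n : ℕ)
    (hf : ∀ i < n, Finite (Submodule.torsion R
      (A (a + i) ⧸ Submodule.comap (A (a + i)).subtype (A (a + i + 1))))) :
    Nat.card (Submodule.torsion R (A a)) ≤ (∏ i ∈ Finset.range n,
      Nat.card (Submodule.torsion R
        (A (a + i) ⧸ Submodule.comap (A (a + i)).subtype (A (a + i + 1)))))
      * Nat.card (Submodule.torsion R (A (a + n))) := by
  induction n with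
  | zero =>
    have h0 : a + ((0 : ℕ) : ℤ) = a := by simp
    rw [h0, Finset.prod_range_zero, one_mul]
  | succ n ih =>
    have ih' := ih (fun i hi => hf i (by omega))
    have h1 := aux_tor_ses (Submodule.comap (A (a + n)).subtype (A (a + n + 1)))
      (aux_tor_sub _ hH) (hf n (by omega))
    have h2 := aux_tor_equiv (Submodule.comapSubtypeEquivOfLe (hA (a + n)))
    have h3 : a + ((n + 1 : ℕ) : ℤ) = a + n + 1 := by push_cast; ring
    rw [Finset.prod_range_succ, h3, mul_assoc, ← h2]
    exact ih'.trans (Nat.mul_le_mul_left _ h1)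

theorem aux_rank_pi {R : Type*} {n : ℕ} {M : Fin n → Type*} [CommRing R] [IsDomain R]
    [∀ i, AddCommGroup (M i)] [∀ i, Module R (M i)] [∀ i, Module.Finite R (M i)] :
    ∑ i, Module.finrank R (M i) ≤ Module.finrank R (∀ i, M i) := by
  induction n with
  | zero => simp
  | succ n ih =>
    rw [Fin.sum_univ_succ, ← (Fin.consLinearEquiv R M).finrank_eq]
    refine (Nat.add_le_add_left (ih (M := fun i => M i.succ)) _).trans ?_
    have h := lift_rank_add_lift_rank_le_rank_prod R (M 0) (∀ i : Fin n, M i.succ)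
    rw [← Module.finrank_eq_rank, ← Module.finrank_eq_rank, ← Module.finrank_eq_rank] at h
    rw [Cardinal.lift_natCast, Cardinal.lift_natCast] at h
    exact_mod_cast h

open DirectSum in
/-- The inclusion of finitely many summands. -/
def auxInc {R : Type*} {M : ℤ → Type*} [CommRing R]
    [∀ i, AddCommGroup (M i)] [∀ i, Module R (M i)] {n : ℕ} (e : Fin n → ℤ) :
    (∀ i, M (e i)) →ₗ[R] (⨁ p, M p) :=
  ∑ i, (DirectSum.lof R ℤ M (e i)) ∘ₗ LinearMap.proj i

open DirectSum in
theorem auxInc_apply {R : Type*} {M : ℤ → Type*} [CommRing R]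
    [∀ i, AddCommGroup (M i)] [∀ i, Module R (M i)] {n : ℕ} (e : Fin n → ℤ)
    (he : Function.Injective e) (x : ∀ i, M (e i)) (j : Fin n) :
    auxInc (R := R) (M := M) e x (e j) = x j := by
  simp only [auxInc, LinearMap.sum_apply, LinearMap.comp_apply, LinearMap.proj_apply]
  rw [DFinsupp.finsetSum_apply, Finset.sum_eq_single j]
  · exact DirectSum.lof_apply R _ _
  · intro b _ hb
    exact DirectSum.of_eq_of_ne _ _ _ (fun h => hb (he h.symm))
  · simp

open DirectSum in
theorem auxInc_inj {R : Type*} {M : ℤ → Type*} [CommRing R]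
    [∀ i, AddCommGroup (M i)] [∀ i, Module R (M i)] {n : ℕ} (e : Fin n → ℤ)
    (he : Function.Injective e) : Function.Injective (auxInc (R := R) (M := M) e) := by
  intro x y h
  funext j
  rw [← auxInc_apply (R := R) e he x j, h, auxInc_apply e he]

theorem aux_tor_map {R M N : Type*} [CommRing R] [AddCommGroup N] [Module R N]
    [AddCommGroup M] [Module R M] (f : M →ₗ[R] N) (x : M) (hx : x ∈ Submodule.torsion R M) :
    f x ∈ Submodule.torsion R N := by
  rw [Submodule.mem_torsion_iff] at hx ⊢
  obtain ⟨a, ha⟩ := hx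
  refine ⟨a, ?_⟩
  have : a • f x = f (a • x) := (f.map_smul (a : R) x).symm
  rw [this, ha, map_zero]

open DirectSum in
theorem aux_sum_tor {R : Type*} {M : ℤ → Type*} [CommRing R] [IsDomain R]
    [∀ i, AddCommGroup (M i)] [∀ i, Module R (M i)] {n : ℕ} (e : Fin n → ℤ)
    (he : Function.Injective e) (hfin : Finite (Submodule.torsion R (⨁ p, M p))) :
    ∏ i, Nat.card (Submodule.torsion R (M (e i))) ≤
      Nat.card (Submodule.torsion R (⨁ p, M p)) := by
  rw [← Nat.card_pi]
  refine Nat.card_le_card_of_injective (fun x => ⟨auxInc (R := R) e (fun i => (x i : M (e i))), ?_⟩) ?_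
  · simp only [auxInc, LinearMap.sum_apply, LinearMap.comp_apply, LinearMap.proj_apply]
    exact Submodule.sum_mem _ fun i _ => aux_tor_map _ _ (x i).2
  · intro x y h
    have := auxInc_inj (R := R) e he (congrArg Subtype.val h)
    funext i
    exact Subtype.ext (congrFun this i)

open DirectSum in
theorem aux_sum_tor_fin {R : Type*} {M : ℤ → Type*} [CommRing R] [IsDomain R]
    [∀ i, AddCommGroup (M i)] [∀ i, Module R (M i)]
    (hfin : Finite (Submodule.torsion R (⨁ p, M p))) (p : ℤ) :
    Finite (Submodule.torsion R (M p)) := by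
  refine Finite.of_injective (β := Submodule.torsion R (⨁ p, M p))
    (fun x => ⟨DirectSum.lof R ℤ M p x, aux_tor_map _ _ x.2⟩) ?_
  intro x y h
  exact Subtype.ext (DirectSum.of_injective p (congrArg Subtype.val h))

end Helpers

namespace FilteredCx

variable {R C : Type*} [CommRing R] [AddCommGroup C] [Module R C]

theorem F_anti (X : FilteredCx R C) {p q : ℤ} (h : p ≤ q) : X.F q ≤ X.F p :=
  iSup_mono fun _ => iSup_mono' fun hj => ⟨h.trans hj, le_rfl⟩

theorem F_step (X : FilteredCx R C) {p : ℤ} (h : X.G p = ⊥) : X.F p ≤ X.F (p + 1) := by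
  refine iSup_le fun j => iSup_le fun hj => ?_
  rcases hj.eq_or_lt with rfl | hj
  · rw [h]; exact bot_le
  · exact le_iSup_of_le j (le_iSup_of_le (by omega) le_rfl)

theorem F_top (X : FilteredCx R C) : X.F X.i₀ = ⊤ := by
  rw [eq_top_iff, ← X.internal.submodule_iSup_eq_top]
  refine iSup_le fun j => ?_
  rcases lt_or_ge j X.i₀ with h | h
  · rw [X.hGlow j h]; exact bot_le
  · exact le_iSup_of_le j (le_iSup_of_le h le_rfl)

theorem F_bot (X : FilteredCx R C) {p : ℤ} (h : X.i₁ < p) : X.F p = ⊥ := by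
  rw [eq_bot_iff]
  refine iSup_le fun j => iSup_le fun hj => ?_
  rw [X.hGhigh j (by omega)]

theorem FH_anti (X : FilteredCx R C) (p : ℤ) : X.FH (p + 1) ≤ X.FH p :=
  Submodule.map_mono (Submodule.comap_mono (X.F_anti (by omega)))

theorem FH_top (X : FilteredCx R C) : X.FH X.i₀ = ⊤ := by
  rw [FH, F_top, Submodule.comap_top, Submodule.map_top, Submodule.range_mkQ]

theorem FH_bot (X : FilteredCx R C) {p : ℤ} (h : X.i₁ < p) : X.FH p = ⊥ := by
  rw [FH, X.F_bot h, eq_bot_iff, Submodule.map_le_iff_le_comap]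
  intro x hx
  have : x = 0 := Subtype.ext hx
  rw [this]; exact Submodule.zero_mem _

/-- Cycles of filtration level `p`. -/
def cyc (X : FilteredCx R C) (p : ℤ) : Submodule R C := X.F p ⊓ LinearMap.ker X.d

theorem cyc_le (X : FilteredCx R C) (r : ℕ) (p : ℤ) : X.cyc p ≤ X.zmod r p := by
  intro x hx
  refine ⟨hx.1, ?_⟩
  change X.d x ∈ X.F (p + r)
  rw [LinearMap.mem_ker.1 hx.2]
  exact Submodule.zero_mem _

/-- The map from cycles to the page. -/
def cycE (X : FilteredCx R C) (r : ℕ) (p : ℤ) : X.cyc p →ₗ[R] X.Epage r p :=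
  (Submodule.mkQ _) ∘ₗ Submodule.inclusion (X.cyc_le r p)

theorem cycE_eq_zero (X : FilteredCx R C) (r : ℕ) (p : ℤ) (x : X.cyc p) :
    X.cycE r p x = 0 ↔ (x : C) ∈ X.bmod r p := by
  rw [cycE, LinearMap.comp_apply, Submodule.mkQ_apply, Submodule.Quotient.mk_eq_zero]
  rfl

/-- The map from cycles to the filtered homology. -/
def cycH (X : FilteredCx R C) (p : ℤ) : X.cyc p →ₗ[R] X.FH p :=
  LinearMap.codRestrict (X.FH p)
    ((Submodule.mkQ _) ∘ₗ Submodule.inclusion (inf_le_right : X.cyc p ≤ LinearMap.ker X.d))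
    (fun x => ⟨⟨x, x.2.2⟩, x.2.1, rfl⟩)

/-- The map from cycles to the graded homology. -/
def cycG (X : FilteredCx R C) (p : ℤ) : X.cyc p →ₗ[R] X.GH p :=
  (Submodule.mkQ _) ∘ₗ X.cycH p

theorem cycG_surj (X : FilteredCx R C) (p : ℤ) : Function.Surjective (X.cycG p) := by
  refine (Submodule.mkQ_surjective _).comp ?_
  rintro ⟨_, y, hy, rfl⟩
  exact ⟨⟨y, hy, y.2⟩, rfl⟩

theorem cycG_eq_zero (X : FilteredCx R C) (p : ℤ) (x : X.cyc p) :
    X.cycG p x = 0 ↔ (x : C) ∈ X.F (p + 1) ⊔ LinearMap.range X.d := by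
  have hx : X.d x = 0 := x.2.2
  have dd : ∀ z, X.d (X.d z) = 0 := fun z => LinearMap.congr_fun X.dd z
  rw [cycG, LinearMap.comp_apply, Submodule.mkQ_apply, Submodule.Quotient.mk_eq_zero,
    Submodule.mem_comap, Submodule.mem_sup]
  constructor
  · rintro ⟨y, hy, h⟩
    have h' := (Submodule.Quotient.eq _).1 h
    obtain ⟨z, hz⟩ := h'
    refine ⟨y, hy, X.d (-z), ⟨-z, rfl⟩, ?_⟩
    have hz' : X.d z = y - x := hz
    rw [map_neg, hz']
    abel
  · rintro ⟨y, hy, _, ⟨z, rfl⟩, h⟩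
    have hy' : X.d y = 0 := by
      have := congrArg X.d h
      rwa [map_add, dd, add_zero, hx] at this
    refine ⟨⟨y, hy'⟩, hy, ?_⟩
    refine (Submodule.Quotient.eq _).2 ⟨-z, ?_⟩
    rw [map_neg]
    change -X.d z = y - x
    rw [← h]; abel

theorem cyc_ker_le (X : FilteredCx R C) (r : ℕ) (p : ℤ) :
    LinearMap.ker (X.cycE r p) ≤ LinearMap.ker (X.cycG p) := by
  intro x hx
  rw [LinearMap.mem_ker, cycE_eq_zero] at hx
  rw [LinearMap.mem_ker, cycG_eq_zero]
  refine (sup_le_sup_left ?_ _ : X.bmod r p ≤ _) hx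
  rintro _ ⟨z, _, rfl⟩
  exact ⟨z, rfl⟩

end FilteredCx

open DirectSum in
/-- If `Tor E^{r₀}(C)` is finite, `rank_R E^{r₀}(C) = rank_R H_*(C)` and
`|Tor E^{r₀}(C)| = |Tor H_*(C)|`, then the spectral sequence degenerates at `r₀`:
all differentials `d^r_p` with `r ≥ r₀` vanish. -/
theorem stmt15 {R C : Type*} [CommRing R] [IsDomain R] [IsPrincipalIdealRing R]
    [AddCommGroup C] [Module R C] [Module.Finite R C] [Module.Free R C]
    (X : FilteredCx R C) (r₀ : ℕ)
    (hfin : Finite (Submodule.torsion R (⨁ p : ℤ, X.Epage r₀ p)))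
    (hrank : Module.rank R (⨁ p : ℤ, X.Epage r₀ p) = Module.rank R X.Hmod)
    (hcard : Nat.card (Submodule.torsion R (⨁ p : ℤ, X.Epage r₀ p)) =
      Nat.card (Submodule.torsion R X.Hmod)) :
    ∀ (r : ℕ), r₀ ≤ r → ∀ (p : ℤ) (x : C) (_ : x ∈ X.zmod r p)
      (hdx : X.d x ∈ X.zmod r (p + r)),
      X.eClass r (p + r) (X.d x) hdx = 0 := by
  have hfinp : ∀ p, Finite (Submodule.torsion R (X.Epage r₀ p)) := aux_sum_tor_fin hfin
  have hpos : 0 < Nat.card (Submodule.torsion R X.Hmod) := by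
    rw [← hcard]; exact Nat.card_pos
  have hH : Finite (Submodule.torsion R X.Hmod) := Nat.finite_of_card_ne_zero hpos.ne'
  obtain ⟨n, hn⟩ : ∃ n : ℕ, X.i₁ < X.i₀ + n := ⟨(X.i₁ - X.i₀ + 1).toNat, by omega⟩
  have he : Function.Injective (fun i : Fin n => X.i₀ + ((i : ℕ) : ℤ)) := by
    intro i j h
    have : X.i₀ + ((i : ℕ) : ℤ) = X.i₀ + ((j : ℕ) : ℤ) := h
    exact Fin.ext (by omega)
  have hle : ∀ p, Module.finrank R (X.GH p) ≤ Module.finrank R (X.Epage r₀ p) := fun p =>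
    (aux_rank_le (X.cycE r₀ p) (X.cycG p) (X.cycG_surj p) (X.cyc_ker_le r₀ p)).1
  -- rank comparison
  have hR1 : Module.finrank R X.Hmod =
      ∑ i ∈ Finset.range n, Module.finrank R (X.GH (X.i₀ + i)) := by
    have h := aux_filt_rank X.FH X.FH_anti X.i₀ n
    rw [X.FH_top, X.FH_bot hn, finrank_top, finrank_bot, add_zero] at h
    exact h
  have hR2 : ∑ i ∈ Finset.range n, Module.finrank R (X.Epage r₀ (X.i₀ + i)) ≤
      Module.finrank R X.Hmod := by
    rw [Finset.sum_range]
    refine (aux_rank_pi (R := R) (M := fun i : Fin n => X.Epage r₀ (X.i₀ + ((i : ℕ) : ℤ)))).trans ?_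
    have h := LinearMap.rank_le_of_injective _
      (auxInc_inj (R := R) (M := fun p => X.Epage r₀ p) _ he)
    rw [hrank, ← Module.finrank_eq_rank, ← Module.finrank_eq_rank] at h
    exact_mod_cast h
  have hReq : ∀ i ∈ Finset.range n, Module.finrank R (X.GH (X.i₀ + i)) =
      Module.finrank R (X.Epage r₀ (X.i₀ + i)) :=
    (Finset.sum_eq_sum_iff_of_le fun i _ => hle _).1
      (le_antisymm (Finset.sum_le_sum fun i _ => hle _) (hR1 ▸ hR2))
  have hT : ∀ i ∈ Finset.range n, _ := fun i hi =>
    aux_tor (X.cycE r₀ (X.i₀ + i)) (X.cycG _) (X.cycG_surj _) (X.cyc_ker_le r₀ _)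
      ((aux_rank_le (X.cycE r₀ _) (X.cycG _) (X.cycG_surj _) (X.cyc_ker_le r₀ _)).2 (hReq i hi))
      (hfinp _)
  -- torsion comparison
  have hC1 : Nat.card (Submodule.torsion R X.Hmod) ≤
      ∏ i ∈ Finset.range n, Nat.card (Submodule.torsion R (X.GH (X.i₀ + i))) := by
    have h := aux_filt_tor hH X.FH X.FH_anti X.i₀ n
      (fun i hi => (hT i (Finset.mem_range.2 hi)).1)
    rw [X.FH_top, X.FH_bot hn, aux_tor_equiv (Submodule.topEquiv)] at h
    have h1 : Nat.card (Submodule.torsion R (⊥ : Submodule R X.Hmod)) = 1 :=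
      Nat.card_unique
    rw [h1, mul_one] at h
    exact h
  have hC2 : ∏ i ∈ Finset.range n, Nat.card (Submodule.torsion R (X.Epage r₀ (X.i₀ + i))) ≤
      Nat.card (Submodule.torsion R X.Hmod) := by
    rw [Finset.prod_range, ← hcard]
    exact aux_sum_tor (R := R) (M := fun p => X.Epage r₀ p) _ he hfin
  have hCeq : ∀ i ∈ Finset.range n, Nat.card (Submodule.torsion R (X.GH (X.i₀ + i))) =
      Nat.card (Submodule.torsion R (X.Epage r₀ (X.i₀ + i))) := by
    intro i hi
    by_contra hne
    have hlt := Finset.prod_lt_prod (s := Finset.range n)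
      (f := fun i : ℕ => Nat.card (Submodule.torsion R (X.GH (X.i₀ + i))))
      (g := fun i : ℕ => Nat.card (Submodule.torsion R (X.Epage r₀ (X.i₀ + i))))
      (fun i hi => by
        have := (hT i hi).1
        exact Nat.card_pos)
      (fun i hi => (hT i hi).2.1)
      ⟨i, hi, lt_of_le_of_ne (hT i hi).2.1 hne⟩
    exact absurd (hC1.trans_lt (hlt.trans_le hC2)) (lt_irrefl _)
  intro r hr p x hx hdx
  have dd : ∀ z, X.d (X.d z) = 0 := fun z => LinearMap.congr_fun X.dd z
  rw [FilteredCx.eClass, Submodule.Quotient.mk_eq_zero]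
  change X.d x ∈ X.bmod r (p + r)
  by_cases hG : X.G (p + r) = ⊥
  · exact Submodule.mem_sup_left (X.F_step hG hdx.1)
  have hlow : X.i₀ ≤ p + r := by
    by_contra h
    exact hG (X.hGlow _ (by omega))
  have hhigh : p + r ≤ X.i₁ := by
    by_contra h
    exact hG (X.hGhigh _ (by omega))
  obtain ⟨i, hi⟩ : ∃ i : ℕ, p + r = X.i₀ + i := ⟨(p + r - X.i₀).toNat, by omega⟩
  have hin : i ∈ Finset.range n := Finset.mem_range.2 (by omega)
  have hcyc : X.d x ∈ X.cyc (X.i₀ + i) := by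
    rw [← hi]
    exact ⟨hdx.1, dd x⟩
  have hz := (hT i hin).2.2 (hCeq i hin) ⟨X.d x, hcyc⟩
    ((X.cycG_eq_zero _ _).2 (Submodule.mem_sup_right ⟨x, rfl⟩))
  rw [X.cycE_eq_zero] at hz
  change X.d x ∈ X.bmod r₀ (X.i₀ + i) at hz
  rw [← hi] at hz
  refine (sup_le_sup_left (Submodule.map_mono (X.F_anti ?_)) _ : X.bmod r₀ (p + r) ≤ _) hz
  omega
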